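/- arXiv:math/0009095 — 3 statements merged into one kernel-verified Lean document; each statement's English description precedes it below -/
import Mathlib

section
/- Let m ≥ 2 and let Q be a quadratic form on ℝᵐ that is indefinite, i.e. there exist vectors u, v ∈ ℝᵐ with Q(u) > 0 and Q(v) < 0. Then there exists a basis v₁, …, v_m of ℝᵐ consisting of isotropic vectors of Q, i.e. with Q(vⱼ) = 0 for all 1 ≤ j ≤ m. -/
/-- If a real quadratic form is positive at `a` and negative at `b`, then `a` and `b` lie in the
span of the isotropic vectors: the line `a + t • b` carries two of them. -/
theorem QuadraticMap.mem_span_isotropic_of_pos_of_neg {M : Type*} [AddCommGroup M] [Module ℝ M]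
    (Q : QuadraticForm ℝ M) {a b : M} (ha : 0 < Q a) (hb : Q b < 0) :
    a ∈ Submodule.span ℝ {x | Q x = 0} ∧ b ∈ Submodule.span ℝ {x | Q x = 0} := by
  set S := Submodule.span ℝ {x | Q x = 0}
  have hline (t : ℝ) : Q (a + t • b) = Q b * (t * t) + QuadraticMap.polar Q a b * t + Q a := by
    rw [QuadraticMap.map_add Q, QuadraticMap.map_smul, QuadraticMap.polar_smul_right]
    simp only [smul_eq_mul]
    ring
  have hdisc : 0 < discrim (Q b) (QuadraticMap.polar Q a b) (Q a) := by
    unfold discrim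
    nlinarith [sq_nonneg (QuadraticMap.polar Q a b), mul_neg_of_neg_of_pos hb ha]
  set s := √(discrim (Q b) (QuadraticMap.polar Q a b) (Q a))
  have hs0 : 0 < s := Real.sqrt_pos.2 hdisc
  have hss : discrim (Q b) (QuadraticMap.polar Q a b) (Q a) = s * s :=
    (Real.mul_self_sqrt hdisc.le).symm
  have hroot (t : ℝ) (ht : t = (-QuadraticMap.polar Q a b + s) / (2 * Q b) ∨
      t = (-QuadraticMap.polar Q a b - s) / (2 * Q b)) : a + t • b ∈ S := by
    refine Submodule.subset_span ?_
    rw [Set.mem_ofPred_eq, hline]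
    exact (quadratic_eq_zero_iff hb.ne hss t).2 ht
  have h₁ := hroot _ (Or.inl rfl)
  have h₂ := hroot _ (Or.inr rfl)
  have hbS : b ∈ S := by
    have h := S.sub_mem h₁ h₂
    rw [add_sub_add_left_eq_sub, ← sub_smul] at h
    refine (S.smul_mem_iff ?_).1 h
    rw [← sub_div]
    refine div_ne_zero ?_ (mul_ne_zero two_ne_zero hb.ne)
    linarith
  exact ⟨(S.add_mem_iff_left (S.smul_mem _ hbS)).1 h₁, hbS⟩

/-- The isotropic vectors of an indefinite real quadratic form span the whole space. -/
theorem QuadraticMap.span_isotropic_eq_top {M : Type*} [AddCommGroup M] [Module ℝ M]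
    (Q : QuadraticForm ℝ M) {u v : M} (hu : 0 < Q u) (hv : Q v < 0) :
    Submodule.span ℝ {x | Q x = 0} = ⊤ := by
  refine Submodule.eq_top_iff'.2 fun w => ?_
  rcases lt_trichotomy (Q w) 0 with hw | hw | hw
  · exact (Q.mem_span_isotropic_of_pos_of_neg hu hw).2
  · exact Submodule.subset_span hw
  · exact (Q.mem_span_isotropic_of_pos_of_neg hw hv).1

theorem Matrix.toQuadraticForm'_eq_sum {R n : Type*} [CommRing R] [Fintype n] [DecidableEq n]
    (A : Matrix n n R) (x : n → R) :
    A.toQuadraticForm' x = ∑ k, ∑ l, A k l * x k * x l := by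
  simp only [Matrix.toQuadraticForm', LinearMap.BilinMap.toQuadraticMap_apply,
    Matrix.toLinearMap₂'_apply, smul_eq_mul]
  exact Finset.sum_congr rfl fun k _ => Finset.sum_congr rfl fun l _ => by ring

/-- An indefinite quadratic form on `ℝᵐ` (given by a symmetric matrix `A`,
`m ≥ 2`) admits a basis of `ℝᵐ` consisting of isotropic vectors. -/
theorem stmt_2 (m : ℕ) (hm : 2 ≤ m) (A : Matrix (Fin m) (Fin m) ℝ)
    (hA : A.IsSymm)
    (u : Fin m → ℝ) (hu : 0 < ∑ k, ∑ l, A k l * u k * u l)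
    (v : Fin m → ℝ) (hv : ∑ k, ∑ l, A k l * v k * v l < 0) :
    ∃ b : Fin m → (Fin m → ℝ),
      LinearIndependent ℝ b ∧
      Submodule.span ℝ (Set.range b) = ⊤ ∧
      ∀ j : Fin m, ∑ k, ∑ l, A k l * b j k * b j l = 0 := by
  simp only [← Matrix.toQuadraticForm'_eq_sum] at hu hv ⊢
  have hspan := A.toQuadraticForm'.span_isotropic_eq_top hu hv
  let B := Module.Basis.ofSpan hspan.ge
  let b := B.reindex (B.indexEquiv (Pi.basisFun ℝ (Fin m)))
  refine ⟨b, b.linearIndependent, b.span_eq, fun j => ?_⟩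
  refine Module.Basis.ofSpan_subset hspan.ge ?_
  rw [← Module.Basis.range_reindex B (B.indexEquiv (Pi.basisFun ℝ (Fin m)))]
  exact Set.mem_range_self j
end

section
/- On ℝ⁴ with coordinates (x,y,z,w), consider the vector fields Y₁(x,y,z,w) = (1+z, 1, 1, 1+y) and Y₂(x,y,z,w) = (0, 1, −2, −(1+y)). Then the flat symmetric products satisfy the pointwise linear relation ⟨Y₂:Y₂⟩(q) = −⟨Y₁:Y₂⟩(q) − ⟨Y₁:Y₁⟩(q) for every q ∈ ℝ⁴. -/
/-- The flat symmetric product of vector fields on `ℝⁿ`: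
`⟨X:Y⟩(q) = DY(q)(X(q)) + DX(q)(Y(q))`. -/
noncomputable def symProd {n : ℕ} (X Y : (Fin n → ℝ) → (Fin n → ℝ)) :
    (Fin n → ℝ) → (Fin n → ℝ) :=
  fun q => fderiv ℝ Y q (X q) + fderiv ℝ X q (Y q)

/-- The input vector field `Y₁ = (1+z, 1, 1, 1+y)` on `ℝ⁴` with coordinates
`(x, y, z, w) = (q 0, q 1, q 2, q 3)`. -/
def Yone : (Fin 4 → ℝ) → (Fin 4 → ℝ) :=
  fun q => ![1 + q 2, 1, 1, 1 + q 1]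

/-- The input vector field `Y₂ = (0, 1, -2, -(1+y))` on `ℝ⁴`. -/
def Ytwo : (Fin 4 → ℝ) → (Fin 4 → ℝ) :=
  fun q => ![0, 1, -2, -(1 + q 1)]

theorem fderiv_Yone_apply (q v : Fin 4 → ℝ) :
    fderiv ℝ Yone q v = ![v 2, 0, 0, v 1] := by
  have h : HasFDerivAt Yone (ContinuousLinearMap.pi
      ![ContinuousLinearMap.proj 2, 0, 0, ContinuousLinearMap.proj 1] :
        (Fin 4 → ℝ) →L[ℝ] (Fin 4 → ℝ)) q := by
    refine hasFDerivAt_pi.2 fun i => ?_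
    fin_cases i
    · exact (hasFDerivAt_apply (𝕜 := ℝ) (2 : Fin 4) q).const_add 1
    · exact hasFDerivAt_const 1 q
    · exact hasFDerivAt_const 1 q
    · exact (hasFDerivAt_apply (𝕜 := ℝ) (1 : Fin 4) q).const_add 1
  rw [h.fderiv]
  ext i
  fin_cases i <;> simp

theorem fderiv_Ytwo_apply (q v : Fin 4 → ℝ) :
    fderiv ℝ Ytwo q v = ![0, 0, 0, -v 1] := by
  have h : HasFDerivAt Ytwo (ContinuousLinearMap.pi
      ![0, 0, 0, -ContinuousLinearMap.proj 1] :
        (Fin 4 → ℝ) →L[ℝ] (Fin 4 → ℝ)) q := by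
    refine hasFDerivAt_pi.2 fun i => ?_
    fin_cases i
    · exact hasFDerivAt_const 0 q
    · exact hasFDerivAt_const 1 q
    · exact hasFDerivAt_const (-2) q
    · exact ((hasFDerivAt_apply (𝕜 := ℝ) (1 : Fin 4) q).const_add 1).neg
  rw [h.fderiv]
  ext i
  fin_cases i <;> simp

/-- The pointwise linear relation among the flat symmetric products of the
example: `⟨Y₂:Y₂⟩ = -⟨Y₁:Y₂⟩ - ⟨Y₁:Y₁⟩` at every point of `ℝ⁴`. -/
theorem stmt_10 :
    ∀ q : Fin 4 → ℝ,
      symProd Ytwo Ytwo q = -(symProd Yone Ytwo q) - symProd Yone Yone q := by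
  intro q
  simp only [symProd, fderiv_Yone_apply, fderiv_Ytwo_apply]
  ext i
  fin_cases i <;> simp [Yone, Ytwo] <;> norm_num
end

section
/- On ℝ⁴ with coordinates (x,y,z,w), consider the vector fields Y₁(x,y,z,w) = (1+z, 1, 1, 1+y) and Y₂(x,y,z,w) = (0, 1, −2, −(1+y)). Then for every q ∈ ℝ⁴ the four vectors Y₁(q), Y₂(q), ⟨Y₁:Y₂⟩(q), ⟨Y₁:Y₁⟩(q) are linearly independent and span ℝ⁴. -/
theorem hasFDerivAt_Yone (q : Fin 4 → ℝ) :
    HasFDerivAt Yone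
      (ContinuousLinearMap.pi
        ![ContinuousLinearMap.proj (R := ℝ) (φ := fun _ : Fin 4 => ℝ) 2, 0, 0,
          ContinuousLinearMap.proj 1]) q := by
  refine hasFDerivAt_pi.2 fun i => ?_
  fin_cases i
  · exact (hasFDerivAt_apply (𝕜 := ℝ) (F' := fun _ : Fin 4 => ℝ) 2 q).const_add 1
  · exact hasFDerivAt_const (1 : ℝ) q
  · exact hasFDerivAt_const (1 : ℝ) q
  · exact (hasFDerivAt_apply (𝕜 := ℝ) (F' := fun _ : Fin 4 => ℝ) 1 q).const_add 1

theorem hasFDerivAt_Ytwo (q : Fin 4 → ℝ) :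
    HasFDerivAt Ytwo
      (ContinuousLinearMap.pi
        ![0, 0, 0, -ContinuousLinearMap.proj (R := ℝ) (φ := fun _ : Fin 4 => ℝ) 1]) q := by
  refine hasFDerivAt_pi.2 fun i => ?_
  fin_cases i
  · exact hasFDerivAt_const (0 : ℝ) q
  · exact hasFDerivAt_const (1 : ℝ) q
  · exact hasFDerivAt_const (-2 : ℝ) q
  · exact ((hasFDerivAt_apply (𝕜 := ℝ) (F' := fun _ : Fin 4 => ℝ) 1 q).const_add 1).neg

theorem symProd_Yone_Ytwo (q : Fin 4 → ℝ) : symProd Yone Ytwo q = ![-2, 0, 0, 0] := by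
  rw [symProd, (hasFDerivAt_Yone q).fderiv, (hasFDerivAt_Ytwo q).fderiv]
  ext i
  fin_cases i <;> simp [Yone, Ytwo]

theorem symProd_Yone_Yone (q : Fin 4 → ℝ) : symProd Yone Yone q = ![2, 0, 0, 2] := by
  rw [symProd, (hasFDerivAt_Yone q).fderiv]
  ext i
  fin_cases i <;> simp [Yone] <;> norm_num

/-- Local configuration accessibility of the example: at every point `q ∈ ℝ⁴`
the four vectors `Y₁(q), Y₂(q), ⟨Y₁:Y₂⟩(q), ⟨Y₁:Y₁⟩(q)` are linearly
independent and span `ℝ⁴`. -/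
theorem stmt_11 :
    ∀ q : Fin 4 → ℝ,
      LinearIndependent ℝ
        ![Yone q, Ytwo q, symProd Yone Ytwo q, symProd Yone Yone q] ∧
      Submodule.span ℝ
        (Set.range ![Yone q, Ytwo q, symProd Yone Ytwo q, symProd Yone Yone q])
        = ⊤ := by
  intro q
  have hli : LinearIndependent ℝ
      ![Yone q, Ytwo q, symProd Yone Ytwo q, symProd Yone Yone q] := by
    rw [symProd_Yone_Ytwo, symProd_Yone_Yone, Fintype.linearIndependent_iff]
    intro g hg
    have h0 := congrFun hg 0
    have h1 := congrFun hg 1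
    have h2 := congrFun hg 2
    have h3 := congrFun hg 3
    simp [Fin.sum_univ_four, Yone, Ytwo] at h0 h1 h2 h3
    have e0 : g 0 = 0 := by linarith
    have e1 : g 1 = 0 := by linarith
    rw [e0, e1] at h3
    rw [e0] at h0
    have e3 : g 3 = 0 := by linarith
    have e2 : g 2 = 0 := by linarith
    intro i
    fin_cases i <;> assumption
  exact ⟨hli, hli.span_eq_top_of_card_eq_finrank (by simp)⟩
end
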